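/- arXiv:1312.3843 — 3 statements merged into one kernel-verified Lean document; each statement's English description precedes it below -/
import Mathlib

section
/- Let d ≥ 1 be an integer and let r, q ∈ (2, ∞) satisfy 1/r + d/(2q) = d/4. Then there exists a constant N, depending only on d, r, q, such that for every continuously differentiable function v : ℝ × ℝ^d → ℝ with compact support, ( ∫_ℝ ( ∫_{ℝ^d} |v(t,x)|^q dx )^{r/q} dt )^{2/r} ≤ N ( sup_{t ∈ ℝ} ∫_{ℝ^d} |v(t,x)|^2 dx + ∫_ℝ ∫_{ℝ^d} |∇_x v(t,x)|^2 dx dt ), where ∇_x v denotes the gradient of v in the spatial variables x. -/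
open MeasureTheory Real

open scoped ENNReal NNReal

/-- The Gagliardo-Nirenberg inequality on `ℝ^d` bounding the `L^q` norm of a compactly supported
`C¹` function by the `L²` norms of the function and of its gradient. -/
def GagliardoNirenberg (d : ℕ) (q : ℝ) : Prop :=
  ∃ C : ℝ≥0, ∀ u : (Fin d → ℝ) → ℝ, ContDiff ℝ 1 u → HasCompactSupport u →
    ∫⁻ x, ‖u x‖ₑ ^ q ≤ C * ((∫⁻ x, ‖u x‖ₑ ^ (2 : ℝ)) ^ (q / 2 - d * (q - 2) / 4)
      * (∫⁻ x, ‖fderiv ℝ u x‖ₑ ^ (2 : ℝ)) ^ (d * (q - 2) / 4))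

/-- Hölder interpolation between `L²` and `L^Q`. -/
theorem GagliardoNirenberg.mono {d : ℕ} {q Q : ℝ} (h : GagliardoNirenberg d Q) (hq : 2 < q)
    (hqQ : q ≤ Q) (hQ : 0 ≤ Q / 2 - d * (Q - 2) / 4) : GagliardoNirenberg d q := by
  obtain ⟨C, hC⟩ := h
  set l : ℝ := (q - 2) / (Q - 2)
  have hQ2 : 0 < Q - 2 := by linarith
  have hl0 : 0 ≤ l := div_nonneg (by linarith) hQ2.le
  have hl1 : l ≤ 1 := (div_le_one hQ2).2 (by linarith)
  have hlq : l * (Q - 2) = q - 2 := div_mul_cancel₀ _ hQ2.ne'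
  refine ⟨C ^ l, fun u hu h2u ↦ ?_⟩
  have hm : Continuous u := hu.continuous
  calc ∫⁻ x, ‖u x‖ₑ ^ q
      = ∫⁻ x, (‖u x‖ₑ ^ (2 : ℝ)) ^ (1 - l) * (‖u x‖ₑ ^ Q) ^ l := by
        congr! with x
        rw [← ENNReal.rpow_mul, ← ENNReal.rpow_mul, ← ENNReal.rpow_add_of_nonneg]
        · congr 1; linarith
        · nlinarith
        · nlinarith
    _ ≤ (∫⁻ x, ‖u x‖ₑ ^ (2 : ℝ)) ^ (1 - l) * (∫⁻ x, ‖u x‖ₑ ^ Q) ^ l :=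
        ENNReal.lintegral_mul_norm_pow_le (by fun_prop) (by fun_prop) (by linarith) hl0 (by ring)
    _ ≤ _ := by
        grw [hC u hu h2u]
        rw [ENNReal.mul_rpow_of_nonneg _ _ hl0, ENNReal.mul_rpow_of_nonneg _ _ hl0,
          ← ENNReal.rpow_mul, ← ENNReal.rpow_mul, mul_left_comm, ← mul_assoc (_ ^ (1 - l)),
          ← ENNReal.rpow_add_of_nonneg _ _ (by linarith) (by positivity),
          ENNReal.coe_rpow_of_nonneg _ hl0]
        apply le_of_eq
        congr 3
        · linear_combination (1 / 2 - d / 4 : ℝ) * hlq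
        · linear_combination (d / 4 : ℝ) * hlq

theorem lintegral_enorm_fderiv_norm_rpow_le {d : ℕ} {u : (Fin d → ℝ) → ℝ} (hu : ContDiff ℝ 1 u)
    {p : ℝ≥0} (hp : 1 < p) :
    ∫⁻ x, ‖fderiv ℝ (fun x ↦ ‖u x‖ ^ (p : ℝ)) x‖ₑ ≤
      p * ((∫⁻ x, ‖u x‖ₑ ^ (2 * p - 2 : ℝ)) ^ (1 / 2 : ℝ)
        * (∫⁻ x, ‖fderiv ℝ u x‖ₑ ^ (2 : ℝ)) ^ (1 / 2 : ℝ)) := by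
  have hm : Continuous u := hu.continuous
  have hm' : Continuous (fderiv ℝ u) := hu.continuous_fderiv one_ne_zero
  calc ∫⁻ x, ‖fderiv ℝ (fun x ↦ ‖u x‖ ^ (p : ℝ)) x‖ₑ
      ≤ ∫⁻ x, p * (‖u x‖ₑ ^ ((p : ℝ) - 1) * ‖fderiv ℝ u x‖ₑ) := by
        gcongr with x
        rw [← mul_assoc]
        exact enorm_fderiv_norm_rpow_le (hu.differentiable one_ne_zero) hp
    _ = p * ∫⁻ x, ‖u x‖ₑ ^ ((p : ℝ) - 1) * ‖fderiv ℝ u x‖ₑ :=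
        lintegral_const_mul _ (by fun_prop)
    _ ≤ _ := by
        gcongr
        refine (ENNReal.lintegral_mul_le_Lp_mul_Lq volume Real.HolderConjugate.two_two
          (f := fun x ↦ ‖u x‖ₑ ^ ((p : ℝ) - 1)) (by fun_prop) (by fun_prop)).trans_eq ?_
        simp_rw [← ENNReal.rpow_mul]
        ring_nf

theorem enorm_le_lintegral_enorm_fderiv_fin_one {v : (Fin 1 → ℝ) → ℝ} (hv : ContDiff ℝ 1 v)
    (h2v : HasCompactSupport v) (x : Fin 1 → ℝ) : ‖v x‖ₑ ≤ ∫⁻ y, ‖fderiv ℝ v y‖ₑ := by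
  let e : ℝ ≃L[ℝ] (Fin 1 → ℝ) := (ContinuousLinearEquiv.funUnique (Fin 1) ℝ ℝ).symm
  have he : MeasurePreserving (MeasurableEquiv.funUnique (Fin 1) ℝ).symm :=
    (volume_preserving_funUnique (Fin 1) ℝ).symm
  have hx : v x = (v ∘ e) (x 0) := by
    simp only [Function.comp]
    congr 1
    ext i
    simp [e, Subsingleton.elim i 0]
  rw [hx, ← he.lintegral_comp (f := fun y ↦ ‖fderiv ℝ v y‖ₑ)
    (hv.continuous_fderiv one_ne_zero).enorm.measurable]
  refine (HasCompactSupport.enorm_le_lintegral_Ici_deriv (hv.comp e.contDiff)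
    (h2v.comp_homeomorph e.toHomeomorph) _).trans ((setLIntegral_le_lintegral _ _).trans ?_)
  refine lintegral_mono fun y ↦ ?_
  have hd : deriv (v ∘ e) y = fderiv ℝ v (e y) (e 1) := by
    rw [← fderiv_apply_one_eq_deriv,
      fderiv_comp _ (hv.differentiable one_ne_zero _) e.differentiableAt, e.fderiv]
    rfl
  have he1 : ‖e 1‖ₑ = 1 := by
    have : e 1 = fun _ ↦ (1 : ℝ) := by ext; simp [e]
    rw [this, ← ofReal_norm, pi_norm_const]
    simp
  rw [hd]
  refine (ContinuousLinearMap.le_opENorm _ _).trans_eq ?_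
  rw [he1, mul_one]
  rfl

theorem gagliardoNirenberg_one {q : ℝ} (hq : 2 < q) : GagliardoNirenberg 1 q := by
  refine ⟨2 ^ ((q - 2) / 2), fun u hu h2u ↦ ?_⟩
  have hm : Continuous u := hu.continuous
  set A := ∫⁻ x, ‖u x‖ₑ ^ (2 : ℝ)
  set G := ∫⁻ x, ‖fderiv ℝ u x‖ₑ ^ (2 : ℝ)
  have hsup (x : Fin 1 → ℝ) : ‖u x‖ₑ ^ (2 : ℝ) ≤ 2 * (A ^ (1 / 2 : ℝ) * G ^ (1 / 2 : ℝ)) := by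
    have h := enorm_le_lintegral_enorm_fderiv_fin_one (v := fun x ↦ ‖u x‖ ^ ((2 : ℝ≥0) : ℝ))
      (hu.norm_rpow (by norm_num)) (h2u.norm.rpow_const (by norm_num)) x
    have h' := h.trans (lintegral_enorm_fderiv_norm_rpow_le hu (by norm_num))
    rw [Real.enorm_rpow_of_nonneg (by positivity) (by positivity), enorm_norm] at h'
    have h2 : 2 * ((2 : ℝ≥0) : ℝ) - 2 = 2 := by norm_num
    rw [h2] at h'
    exact h'
  have hq' : 0 ≤ (q - 2) / 2 := by linarith
  calc ∫⁻ x, ‖u x‖ₑ ^ q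
      = ∫⁻ x, (‖u x‖ₑ ^ (2 : ℝ)) ^ ((q - 2) / 2) * ‖u x‖ₑ ^ (2 : ℝ) := by
        congr! with x
        rw [← ENNReal.rpow_mul, ← ENNReal.rpow_add_of_nonneg _ _ (by linarith) (by norm_num)]
        congr 1; ring
    _ ≤ ∫⁻ x, (2 * (A ^ (1 / 2 : ℝ) * G ^ (1 / 2 : ℝ))) ^ ((q - 2) / 2) * ‖u x‖ₑ ^ (2 : ℝ) := by
        gcongr with x
        exact hsup x
    _ = (2 * (A ^ (1 / 2 : ℝ) * G ^ (1 / 2 : ℝ))) ^ ((q - 2) / 2) * A :=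
        lintegral_const_mul _ (by fun_prop)
    _ = _ := by
        rw [ENNReal.mul_rpow_of_nonneg _ _ hq', ENNReal.mul_rpow_of_nonneg _ _ hq',
          ← ENNReal.rpow_mul, ← ENNReal.rpow_mul, ENNReal.coe_rpow_of_nonneg _ hq']
        have hexp : q / 2 - ((1 : ℕ) : ℝ) * (q - 2) / 4 = 1 / 2 * ((q - 2) / 2) + 1 := by
          push_cast; ring
        rw [hexp, ENNReal.rpow_add_of_nonneg _ _ (by linarith) zero_le_one, ENNReal.rpow_one]
        push_cast
        ring_nf

theorem gagliardoNirenberg_two_nat (k : ℕ) : GagliardoNirenberg 2 (2 * k + 2) := by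
  induction k with
  | zero => exact ⟨1, fun u _ _ ↦ by simp⟩
  | succ k ih =>
    obtain ⟨C, hC⟩ := ih
    set K := lintegralPowLePowLIntegralFDerivConst (volume : Measure (Fin 2 → ℝ)) 2
    refine ⟨K * (k + 2) ^ (2 : ℝ) * C, fun u hu h2u ↦ ?_⟩
    set A := ∫⁻ x, ‖u x‖ₑ ^ (2 : ℝ)
    set G := ∫⁻ x, ‖fderiv ℝ u x‖ₑ ^ (2 : ℝ)
    set p : ℝ≥0 := k + 2 with hp
    have hp' : (p : ℝ) = k + 2 := by simp [hp]
    have hp1 : 1 < p := lt_of_lt_of_le one_lt_two (by simp [hp])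
    have hS := lintegral_pow_le_pow_lintegral_fderiv volume (u := fun x ↦ ‖u x‖ ^ (p : ℝ))
      (hu.norm_rpow (by exact_mod_cast hp1)) (h2u.norm.rpow_const (by positivity))
      (p := 2) (by simpa using Real.HolderConjugate.two_two)
    grw [lintegral_enorm_fderiv_norm_rpow_le hu hp1] at hS
    have h1 : ∫⁻ x, ‖‖u x‖ ^ (p : ℝ)‖ₑ ^ (2 : ℝ) =
        ∫⁻ x, ‖u x‖ₑ ^ (2 * ((k + 1 : ℕ) : ℝ) + 2) := by
      refine lintegral_congr fun x ↦ ?_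
      rw [Real.enorm_rpow_of_nonneg (by positivity) (by positivity), enorm_norm,
        ← ENNReal.rpow_mul, hp']
      congr 1; push_cast; ring
    have h2 : (2 * p - 2 : ℝ) = 2 * k + 2 := by rw [hp']; ring
    rw [h1, h2] at hS
    have hCu := hC u hu h2u
    have e1 : (2 * (k : ℝ) + 2) / 2 - ((2 : ℕ) : ℝ) * (2 * k + 2 - 2) / 4 = 1 := by
      push_cast; ring
    have e2 : ((2 : ℕ) : ℝ) * (2 * k + 2 - 2) / 4 = k := by push_cast; ring
    have e3 : (2 * ((k + 1 : ℕ) : ℝ) + 2) / 2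
        - ((2 : ℕ) : ℝ) * (2 * ((k + 1 : ℕ) : ℝ) + 2 - 2) / 4 = 1 := by
      push_cast; ring
    have e4 : ((2 : ℕ) : ℝ) * (2 * ((k + 1 : ℕ) : ℝ) + 2 - 2) / 4 = k + 1 := by push_cast; ring
    rw [e1, e2, ENNReal.rpow_one] at hCu
    rw [e3, e4, ENNReal.rpow_one]
    grw [hS]
    rw [ENNReal.mul_rpow_of_nonneg _ _ zero_le_two, ENNReal.mul_rpow_of_nonneg _ _ zero_le_two,
      ← ENNReal.rpow_mul, ← ENNReal.rpow_mul]
    norm_num only [ENNReal.rpow_one]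
    rw [ENNReal.rpow_add_of_nonneg _ _ (by positivity) zero_le_one, ENNReal.rpow_one]
    grw [hCu]
    rw [ENNReal.coe_mul, ENNReal.coe_mul, ENNReal.coe_rpow_of_nonneg _ zero_le_two]
    apply le_of_eq
    ring

theorem gagliardoNirenberg_sobolev {d : ℕ} (hd : 3 ≤ d) :
    GagliardoNirenberg d (2 * d / (d - 2)) := by
  have hd' : (3 : ℝ) ≤ d := by exact_mod_cast hd
  have hd2 : (0 : ℝ) < d - 2 := by linarith
  set Q : ℝ≥0 := Real.toNNReal (2 * d / (d - 2))
  have hQ' : (Q : ℝ) = 2 * d / (d - 2) := Real.coe_toNNReal _ (by positivity)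
  have hQ0 : 0 < (Q : ℝ) := by rw [hQ']; positivity
  set K := eLpNormLESNormFDerivOfEqInnerConst (volume : Measure (Fin d → ℝ)) 2
  refine ⟨K ^ (Q : ℝ), fun u hu h2u ↦ ?_⟩
  have h := eLpNorm_le_eLpNorm_fderiv_of_eq_inner (volume : Measure (Fin d → ℝ)) hu h2u
    (p := 2) (p' := Q) one_le_two (by simp; lia) (by
      rw [hQ', Module.finrank_fin_fun]; push_cast; field_simp)
  have h' := ENNReal.rpow_le_rpow h hQ0.le
  rw [ENNReal.mul_rpow_of_nonneg _ _ hQ0.le, eLpNorm_nnreal_pow_eq_lintegral (by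
    exact_mod_cast hQ0.ne'), eLpNorm_nnreal_eq_lintegral two_ne_zero, ← ENNReal.rpow_mul] at h'
  have e1 : (Q : ℝ) / 2 - d * (Q - 2) / 4 = 0 := by rw [hQ']; field_simp; ring
  have e2 : (d : ℝ) * (Q - 2) / 4 = 1 / 2 * Q := by rw [hQ']; field_simp; ring
  rw [← hQ', e1, e2, ENNReal.rpow_zero, one_mul, ENNReal.coe_rpow_of_nonneg _ hQ0.le]
  exact h'

theorem gagliardoNirenberg {d : ℕ} (hd : 1 ≤ d) {q : ℝ} (hq : 2 < q)
    (hdq : d * (q - 2) ≤ 2 * q) : GagliardoNirenberg d q := by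
  obtain rfl | rfl | hd3 : d = 1 ∨ d = 2 ∨ 3 ≤ d := by lia
  · exact gagliardoNirenberg_one hq
  · obtain ⟨k, hk⟩ := exists_nat_ge q
    refine (gagliardoNirenberg_two_nat k).mono hq (by linarith) ?_
    push_cast
    linarith
  · have hd' : (3 : ℝ) ≤ d := by exact_mod_cast hd3
    have hd2 : (0 : ℝ) < d - 2 := by linarith
    refine (gagliardoNirenberg_sobolev hd3).mono hq ?_ (le_of_eq ?_)
    · rw [le_div_iff₀ hd2]; linarith
    · field_simp; ring

theorem lintegral_enorm_rpow_eq_ofReal {X F : Type*} [TopologicalSpace X] [MeasurableSpace X]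
    [OpensMeasurableSpace X] {μ : Measure X} [IsFiniteMeasureOnCompacts μ]
    [NormedAddCommGroup F] {f : X → F} (hf : Continuous f) (h2f : HasCompactSupport f) {p : ℝ}
    (hp : 0 < p) : ∫⁻ x, ‖f x‖ₑ ^ p ∂μ = ENNReal.ofReal (∫ x, ‖f x‖ ^ p ∂μ) := by
  rw [ofReal_integral_eq_lintegral_ofReal]
  · refine lintegral_congr fun x ↦ ?_
    rw [← ENNReal.ofReal_rpow_of_nonneg (norm_nonneg _) hp.le, ofReal_norm]
  · exact (hf.norm.rpow_const fun _ ↦ Or.inr hp.le).integrable_of_hasCompactSupport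
      (h2f.norm.rpow_const hp.ne')
  · exact .of_forall fun x ↦ by positivity

theorem GagliardoNirenberg.exists_integral_le {d : ℕ} {q : ℝ} (h : GagliardoNirenberg d q)
    (hq : 2 < q) (hdq : d * (q - 2) ≤ 2 * q) :
    ∃ C : ℝ, 0 ≤ C ∧ ∀ u : (Fin d → ℝ) → ℝ, ContDiff ℝ 1 u → HasCompactSupport u →
      ∫ x, |u x| ^ q ≤ C * ((∫ x, |u x| ^ (2 : ℝ)) ^ (q / 2 - d * (q - 2) / 4)
        * (∫ x, ‖fderiv ℝ u x‖ ^ 2) ^ (d * (q - 2) / 4)) := by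
  obtain ⟨C, hC⟩ := h
  refine ⟨C, C.2, fun u hu h2u ↦ ?_⟩
  have h := hC u hu h2u
  have hb : 0 ≤ d * (q - 2) / 4 := by
    have : 0 ≤ q - 2 := by linarith
    positivity
  rw [lintegral_enorm_rpow_eq_ofReal hu.continuous h2u (by linarith),
    lintegral_enorm_rpow_eq_ofReal hu.continuous h2u zero_lt_two,
    lintegral_enorm_rpow_eq_ofReal (hu.continuous_fderiv one_ne_zero) (h2u.fderiv ℝ) zero_lt_two,
    ENNReal.ofReal_rpow_of_nonneg (by positivity) (by linarith),
    ENNReal.ofReal_rpow_of_nonneg (by positivity) hb, ← ENNReal.ofReal_mul (by positivity),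
    ← ENNReal.ofReal_coe_nnreal, ← ENNReal.ofReal_mul (by positivity),
    ENNReal.ofReal_le_ofReal_iff (by positivity)] at h
  simpa only [Real.norm_eq_abs, Real.rpow_two] using h

theorem bddAbove_range_integral_rpow {d : ℕ} {v : ℝ → (Fin d → ℝ) → ℝ}
    (hv : Continuous (Function.uncurry v)) (h2v : HasCompactSupport (Function.uncurry v)) {p : ℝ}
    (hp : 0 < p) : BddAbove (Set.range fun t ↦ ∫ x, |v t x| ^ p) := by
  obtain ⟨M, hM⟩ := hv.bounded_above_of_compact_support h2v
  set K := Prod.snd '' tsupport (Function.uncurry v)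
  have hKc : IsCompact K := h2v.isCompact.image continuous_snd
  refine ⟨∫ x, K.indicator (fun _ ↦ M ^ p) x, ?_⟩
  rintro _ ⟨t, rfl⟩
  refine integral_mono_of_nonneg (.of_forall fun x ↦ by positivity)
    ((integrable_indicator_iff hKc.measurableSet).2 (integrableOn_const hKc.measure_lt_top.ne))
    (.of_forall fun x ↦ ?_)
  by_cases hx : x ∈ K
  · simp only [Set.indicator_of_mem hx]
    gcongr
    exact hM (t, x)
  · have h0 : v t x = 0 := by
      by_contra h
      exact hx ⟨(t, x), subset_tsupport _ h, rfl⟩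
    simp [hx, h0, hp.ne']

theorem HasCompactSupport.of_uncurry {X Y F : Type*} [TopologicalSpace X] [T1Space X]
    [TopologicalSpace Y] [Zero F] {v : X → Y → F} (h2v : HasCompactSupport (Function.uncurry v))
    (t : X) : HasCompactSupport (v t) := by
  have hrange : Set.range (Prod.mk t : Y → X × Y) = {t} ×ˢ Set.univ := by
    simp [Set.singleton_prod]
  have hemb : Topology.IsClosedEmbedding (Prod.mk t : Y → X × Y) :=
    ⟨isEmbedding_prodMkRight t, hrange ▸ isClosed_singleton.prod isClosed_univ⟩
  exact h2v.comp_isClosedEmbedding hemb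

theorem integrable_integral_norm_fderiv_sq {d : ℕ} {v : ℝ → (Fin d → ℝ) → ℝ}
    (hv : ContDiff ℝ 1 (Function.uncurry v)) (h2v : HasCompactSupport (Function.uncurry v)) :
    Integrable fun t ↦ ∫ x, ‖fderiv ℝ (v t) x‖ ^ 2 := by
  let L := ContinuousLinearMap.inr ℝ ℝ (Fin d → ℝ)
  have hfd (t : ℝ) (x : Fin d → ℝ) :
      fderiv ℝ (v t) x = (fderiv ℝ (Function.uncurry v) (t, x)).comp L := by
    have h := (hv.differentiable one_ne_zero (t, x)).hasFDerivAt
    exact (h.comp x (f := fun y ↦ (t, y)) (hasFDerivAt_prodMk_right t x)).fderiv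
  have hcont : Continuous fun z : ℝ × (Fin d → ℝ) ↦
      ‖(fderiv ℝ (Function.uncurry v) z).comp L‖ ^ 2 := by
    have := hv.continuous_fderiv one_ne_zero
    fun_prop
  have hsupp : HasCompactSupport fun z : ℝ × (Fin d → ℝ) ↦
      ‖(fderiv ℝ (Function.uncurry v) z).comp L‖ ^ 2 :=
    (h2v.fderiv ℝ).comp_left (g := fun T : ℝ × (Fin d → ℝ) →L[ℝ] ℝ ↦ ‖T.comp L‖ ^ 2) (by simp)
  simp_rw [hfd]
  exact (hcont.integrable_of_hasCompactSupport hsupp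
    (μ := (volume : Measure ℝ).prod volume)).integral_prod_left

/-- **parabolic Ladyzhenskaya embedding.** For `d ≥ 1` and `r, q ∈ (2, ∞)`
with `1/r + d/(2q) = d/4` there is a constant `N = N(d, r, q)` such that for every
compactly supported `C¹` function `v : ℝ × ℝ^d → ℝ`,
`(∫_ℝ (∫_{ℝ^d} |v|^q dx)^{r/q} dt)^{2/r}
  ≤ N (sup_t ∫_{ℝ^d} |v(t,·)|² dx + ∫_ℝ ∫_{ℝ^d} |∇ₓ v|² dx dt)`. -/
theorem statement1 (d : ℕ) (hd : 1 ≤ d) (r q : ℝ) (hr : 2 < r) (hq : 2 < q)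
    (hrq : 1 / r + d / (2 * q) = d / 4) :
    ∃ N : ℝ, 0 < N ∧
      ∀ v : ℝ → (Fin d → ℝ) → ℝ,
        ContDiff ℝ 1 (Function.uncurry v) → HasCompactSupport (Function.uncurry v) →
        (∫ t : ℝ, (∫ x : Fin d → ℝ, |v t x| ^ q) ^ (r / q)) ^ (2 / r)
          ≤ N * ((⨆ t : ℝ, ∫ x : Fin d → ℝ, |v t x| ^ (2 : ℝ))
              + ∫ t : ℝ, ∫ x : Fin d → ℝ, ‖fderiv ℝ (v t) x‖ ^ 2) := by
  have hr0 : 0 < r := by linarith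
  have hq0 : 0 < q := by linarith
  have hscale : d * (q - 2) / 4 * (r / q) = 1 := by
    field_simp at hrq ⊢
    linarith
  have hdq : d * (q - 2) ≤ 2 * q := by
    field_simp at hscale
    have hq4 : 0 ≤ d * (q - 2) := mul_nonneg (by positivity) (by linarith)
    nlinarith
  obtain ⟨C, hC0, hC⟩ := (gagliardoNirenberg hd hq hdq).exists_integral_le hq hdq
  set D := C ^ (r / q)
  have hD0 : 0 ≤ D := by positivity
  refine ⟨D ^ (2 / r) + 1, by positivity, fun v hv h2v ↦ ?_⟩
  set S := ⨆ t : ℝ, ∫ x : Fin d → ℝ, |v t x| ^ (2 : ℝ)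
  set G := ∫ t : ℝ, ∫ x : Fin d → ℝ, ‖fderiv ℝ (v t) x‖ ^ 2 with hG
  have hS0 : 0 ≤ S := Real.iSup_nonneg fun t ↦ by positivity
  have hG0 : 0 ≤ G := by positivity
  have hexp : (q / 2 - d * (q - 2) / 4) * (r / q) = (r - 2) / 2 := by
    have : q / 2 * (r / q) = r / 2 := by field_simp
    linarith
  have hslice (t : ℝ) : (∫ x, |v t x| ^ q) ^ (r / q) ≤
      D * S ^ ((r - 2) / 2) * ∫ x, ‖fderiv ℝ (v t) x‖ ^ 2 := by
    have hvt : ContDiff ℝ 1 (v t) := hv.comp (contDiff_prodMk_right t)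
    have hle : ∫ x, |v t x| ^ (2 : ℝ) ≤ S :=
      le_ciSup (bddAbove_range_integral_rpow hv.continuous h2v zero_lt_two) t
    grw [hC (v t) hvt (h2v.of_uncurry t)]
    rw [Real.mul_rpow hC0 (by positivity), Real.mul_rpow (by positivity) (by positivity),
      ← Real.rpow_mul (by positivity), ← Real.rpow_mul (by positivity), hscale, hexp,
      Real.rpow_one, ← mul_assoc]
    gcongr
  have hint : ∫ t, (∫ x, |v t x| ^ q) ^ (r / q) ≤ D * S ^ ((r - 2) / 2) * G := by
    rw [hG, ← integral_const_mul]
    exact integral_mono_of_nonneg (.of_forall fun t ↦ by positivity)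
      ((integrable_integral_norm_fderiv_sq hv h2v).const_mul _) (.of_forall hslice)
  have hw : 2 / r ≤ 1 := (div_le_one hr0).2 hr.le
  calc (∫ t, (∫ x, |v t x| ^ q) ^ (r / q)) ^ (2 / r)
      ≤ (D * S ^ ((r - 2) / 2) * G) ^ (2 / r) := by
        gcongr
    _ = D ^ (2 / r) * (S ^ (1 - 2 / r) * G ^ (2 / r)) := by
        rw [Real.mul_rpow (by positivity) hG0, Real.mul_rpow hD0 (by positivity),
          ← Real.rpow_mul hS0, mul_assoc]
        congr 4
        field_simp
    _ ≤ D ^ (2 / r) * ((1 - 2 / r) * S + 2 / r * G) := by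
        gcongr
        exact Real.geom_mean_le_arith_mean2_weighted (by linarith) (by positivity) hS0 hG0
          (by ring)
    _ ≤ (D ^ (2 / r) + 1) * (S + G) := by
        have : 0 ≤ 2 / r := by positivity
        gcongr
        · linarith
        · exact mul_le_of_le_one_left hS0 (by linarith)
        · exact mul_le_of_le_one_left hG0 hw
end

section
/- Let d ≥ 1 be an integer and let r̂, q̂ ∈ (2, ∞) satisfy 1/r̂ + d/(2q̂) = d/4. Then there exists a constant N, depending only on d, r̂, q̂ (and in particular independent of p), such that for every real p > 2 and every continuously differentiable function v : ℝ × ℝ^d → ℝ with compact support, ( ∫_ℝ ( ∫_{ℝ^d} |v(t,x)|^{q̂ p/2} dx )^{r̂/q̂} dt )^{2/(r̂ p)·p}, i.e. ( ∫_ℝ ( ∫_{ℝ^d} |v(t,x)|^{q̂ p/2} dx )^{r̂/q̂} dt )^{2/r̂} ≤ N ( sup_{t ∈ ℝ} ∫_{ℝ^d} |v(t,x)|^p dx + (p²/4) ∫_ℝ ∫_{ℝ^d} |∇_x v(t,x)|^2 |v(t,x)|^{p-2} dx dt ), where ∇_x v denotes the gradient of v in the spatial variables x. -/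
open MeasureTheory Real
open scoped ENNReal NNReal

theorem eLpNorm_top_le_eLpNorm_fderiv_one {u : (Fin 1 → ℝ) → ℝ} (hu : ContDiff ℝ 1 u)
    (h2u : HasCompactSupport u) :
    eLpNorm u ∞ volume ≤ eLpNorm (fderiv ℝ u) 1 volume := by
  let e : ℝ ≃L[ℝ] (Fin 1 → ℝ) := (ContinuousLinearEquiv.funUnique (Fin 1) ℝ ℝ).symm
  have hmp : MeasurePreserving (MeasurableEquiv.funUnique (Fin 1) ℝ).symm volume volume :=
    (volume_preserving_funUnique (Fin 1) ℝ).symm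
  have hderiv (y : ℝ) : ‖deriv (u ∘ e) y‖ₑ ≤ ‖fderiv ℝ u (e y)‖ₑ := by
    have h1 : HasDerivAt (u ∘ e) (fderiv ℝ u (e y) (e 1)) y :=
      ((hu.differentiable one_ne_zero (e y)).hasFDerivAt).comp_hasDerivAt y e.hasDerivAt
    rw [h1.deriv, enorm_le_iff_norm_le]
    refine ((fderiv ℝ u (e y)).le_opNorm (e 1)).trans_eq ?_
    have : ‖e 1‖ = 1 := by
      rw [show e 1 = fun _ ↦ (1 : ℝ) from rfl]
      simp
    rw [this, mul_one]
  have hint : ∫⁻ y, ‖fderiv ℝ u (e y)‖ₑ = ∫⁻ x, ‖fderiv ℝ u x‖ₑ :=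
    hmp.lintegral_comp_emb (MeasurableEquiv.measurableEmbedding _) fun x ↦ ‖fderiv ℝ u x‖ₑ
  rw [eLpNorm_exponent_top, eLpNorm_one_eq_lintegral_enorm]
  refine eLpNormEssSup_le_of_ae_enorm_bound (.of_forall fun x ↦ ?_)
  calc ‖u x‖ₑ = ‖(u ∘ e) (e.symm x)‖ₑ := by simp
    _ ≤ ∫⁻ y in Set.Iic (e.symm x), ‖deriv (u ∘ e) y‖ₑ :=
      HasCompactSupport.enorm_le_lintegral_Ici_deriv (hu.comp e.contDiff)
        (h2u.comp_homeomorph e.toHomeomorph) _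
    _ ≤ ∫⁻ y, ‖deriv (u ∘ e) y‖ₑ := setLIntegral_le_lintegral _ _
    _ ≤ ∫⁻ y, ‖fderiv ℝ u (e y)‖ₑ := lintegral_mono hderiv
    _ = _ := hint

theorem exists_eLpNorm_le_mul_eLpNorm_fderiv {d : ℕ} (hd : 1 ≤ d) {p : ℝ≥0} (hp : 1 ≤ p)
    (hp2 : p < 2) {p' : ℝ≥0∞} (hp' : p'⁻¹ + (d : ℝ≥0∞)⁻¹ = (p : ℝ≥0∞)⁻¹) :
    ∃ C : ℝ≥0, ∀ u : (Fin d → ℝ) → ℝ, ContDiff ℝ 1 u → HasCompactSupport u →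
      eLpNorm u p' volume ≤ C * eLpNorm (fderiv ℝ u) p volume := by
  have hp0 : p ≠ 0 := (zero_lt_one.trans_le hp).ne'
  have hd0 : d ≠ 0 := by omega
  induction p' with
  | top =>
    have hdp : (d : ℝ≥0) = p := by
      have := inv_injective (by simpa using hp' : (d : ℝ≥0∞)⁻¹ = (p : ℝ≥0∞)⁻¹)
      exact_mod_cast this
    obtain rfl : d = 1 := by
      have : (d : ℝ≥0) < 2 := hdp ▸ hp2
      have : d < 2 := by exact_mod_cast this
      omega
    obtain rfl : p = 1 := by simpa using hdp.symm
    exact ⟨1, fun u hu h2u ↦ by simpa using eLpNorm_top_le_eLpNorm_fderiv_one hu h2u⟩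
  | coe p' =>
    have hp'0 : p' ≠ 0 := by
      rintro rfl
      simp [eq_comm, hp0] at hp'
    refine ⟨SNormLESNormFDerivOfEqConst ℝ (volume : Measure (Fin d → ℝ)) p, fun u hu h2u ↦
      eLpNorm_le_eLpNorm_fderiv_of_eq volume hu h2u hp (by rw [Module.finrank_fin_fun]; omega) ?_⟩
    have h := congrArg ENNReal.toReal hp'
    rw [ENNReal.toReal_add (by simpa using hp'0) (by simpa using hd0)] at h
    simp only [ENNReal.toReal_inv, ENNReal.coe_toReal, ENNReal.toReal_natCast] at h
    rw [Module.finrank_fin_fun, NNReal.coe_inv]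
    linarith

theorem eLpNorm_le_eLpNorm_rpow_mul_eLpNorm_rpow {α E : Type*} {m : MeasurableSpace α}
    {μ : Measure α} [NormedAddCommGroup E] {f : α → E} (hf : AEStronglyMeasurable f μ)
    {q q₀ q₁ : ℝ≥0∞} {a : ℝ} (ha : 0 < a) (ha1 : a < 1)
    (hq : ENNReal.ofReal (1 - a) * q₀⁻¹ + ENNReal.ofReal a * q₁⁻¹ = q⁻¹) :
    eLpNorm f q μ ≤ eLpNorm f q₀ μ ^ (1 - a) * eLpNorm f q₁ μ ^ a := by
  have hcancel {b : ℝ} (hb : 0 < b) (r : ℝ≥0∞) :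
      r / ENNReal.ofReal b * ENNReal.ofReal b = r ∧
        (r / ENNReal.ofReal b)⁻¹ = ENNReal.ofReal b * r⁻¹ := by
    have hb0 : ENNReal.ofReal b ≠ 0 := by simpa using hb
    exact ⟨ENNReal.div_mul_cancel hb0 ENNReal.ofReal_ne_top,
      by rw [ENNReal.inv_div (.inl ENNReal.ofReal_ne_top) (.inl hb0), div_eq_mul_inv]⟩
  have ha1' := sub_pos.2 ha1
  have : ENNReal.HolderTriple (q₀ / ENNReal.ofReal (1 - a)) (q₁ / ENNReal.ofReal a) q :=
    ⟨by rw [(hcancel ha1' q₀).2, (hcancel ha q₁).2, hq]⟩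
  have hmeas (b : ℝ) : AEStronglyMeasurable (fun x ↦ ‖f x‖ ^ b) μ :=
    (hf.norm.aemeasurable.pow_const b).aestronglyMeasurable
  calc eLpNorm f q μ = eLpNorm ((fun x ↦ ‖f x‖ ^ (1 - a)) • fun x ↦ ‖f x‖ ^ a) q μ := by
        refine eLpNorm_congr_norm_ae (.of_forall fun x ↦ ?_)
        rw [Pi.smul_apply', smul_eq_mul, ← rpow_add_of_nonneg (norm_nonneg _) ha1'.le ha.le]
        simp
    _ ≤ _ := eLpNorm_smul_le_mul_eLpNorm (hmeas a) (hmeas (1 - a))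
    _ = _ := by
        rw [eLpNorm_norm_rpow _ ha, eLpNorm_norm_rpow _ ha1', (hcancel ha1' q₀).1,
          (hcancel ha q₁).1]

theorem HasCompactSupport.abs_rpow {X : Type*} [TopologicalSpace X] {f : X → ℝ}
    (hf : HasCompactSupport f) {s : ℝ} (hs : 0 < s) : HasCompactSupport fun x ↦ |f x| ^ s :=
  hf.comp_left (g := fun y ↦ |y| ^ s) (by simp [hs.ne'])

theorem exists_eLpNorm_le_mul_of_sobolev {d : ℕ} (hd : 1 ≤ d) {p : ℝ≥0} (hp : 1 ≤ p)
    (hp2 : p < 2) {p' : ℝ≥0∞} (hp' : p'⁻¹ + (d : ℝ≥0∞)⁻¹ = (p : ℝ≥0∞)⁻¹) :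
    ∃ C : ℝ≥0, ∀ w : (Fin d → ℝ) → ℝ, ContDiff ℝ 1 w → HasCompactSupport w →
      eLpNorm w (p' * ENNReal.ofReal (2 / p)) volume
        ≤ C * (eLpNorm w 2 volume ^ (1 - p / 2 : ℝ)
          * eLpNorm (fderiv ℝ w) 2 volume ^ (p / 2 : ℝ)) := by
  obtain ⟨C, hC⟩ := exists_eLpNorm_le_mul_eLpNorm_fderiv hd hp hp2 hp'
  have hp0 : (0 : ℝ) < p := by exact_mod_cast zero_lt_one.trans_le hp
  have hp2' : (p : ℝ) < 2 := by exact_mod_cast hp2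
  set s : ℝ := 2 / p with hs
  have hs1 : 1 < s := by rw [hs, lt_div_iff₀ hp0]; linarith
  have hs0 : 0 < s := by linarith
  have hs1' : 0 < s - 1 := by linarith
  set D : ℝ≥0 := C * s.toNNReal
  refine ⟨D ^ (p / 2 : ℝ), fun w hw h2w ↦ ?_⟩
  have hw1 : Continuous (fderiv ℝ w) := hw.continuous_fderiv one_ne_zero
  have : ENNReal.HolderTriple (2 / ENNReal.ofReal (s - 1)) 2 p := by
    constructor
    rw [ENNReal.inv_div (.inl ENNReal.ofReal_ne_top) (.inl (by simpa using hs1')),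
      ← ENNReal.toReal_eq_toReal_iff' (by finiteness) (by simpa using hp0.ne'),
      ENNReal.toReal_add (by finiteness) (by finiteness)]
    rw [ENNReal.toReal_div, ENNReal.toReal_ofReal hs1'.le]
    simp only [ENNReal.toReal_inv, ENNReal.toReal_ofNat, ENNReal.coe_toReal, hs]
    field_simp
    ring
  have key : eLpNorm w (p' * ENNReal.ofReal s) volume ^ s
      ≤ D * (eLpNorm w 2 volume ^ (s - 1) * eLpNorm (fderiv ℝ w) 2 volume) := by
    calc eLpNorm w (p' * ENNReal.ofReal s) volume ^ s
        = eLpNorm (fun x ↦ ‖w x‖ ^ s) p' volume := (eLpNorm_norm_rpow _ hs0).symm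
      _ ≤ C * eLpNorm (fderiv ℝ fun x ↦ ‖w x‖ ^ s) p volume :=
          hC _ (hw.norm_rpow hs1) (h2w.abs_rpow hs0)
      _ ≤ C * (ENNReal.ofReal s *
            eLpNorm ((fun x ↦ ‖w x‖ ^ (s - 1)) • fderiv ℝ w) p volume) := by
          gcongr
          refine eLpNorm_le_mul_eLpNorm_of_ae_le_mul (.of_forall fun x ↦ ?_) _
          refine (norm_fderiv_norm_rpow_le (hw.differentiable one_ne_zero) hs1).trans_eq ?_
          rw [Pi.smul_apply', norm_smul, norm_of_nonneg (rpow_nonneg (norm_nonneg _) _),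
            mul_assoc]
      _ ≤ C * (ENNReal.ofReal s * (eLpNorm (fun x ↦ ‖w x‖ ^ (s - 1))
            (2 / ENNReal.ofReal (s - 1)) volume * eLpNorm (fderiv ℝ w) 2 volume)) := by
          gcongr
          exact eLpNorm_smul_le_mul_eLpNorm hw1.aestronglyMeasurable
            (hw.continuous.norm.measurable.pow_const _).aestronglyMeasurable
      _ = D * (eLpNorm w 2 volume ^ (s - 1) * eLpNorm (fderiv ℝ w) 2 volume) := by
          rw [eLpNorm_norm_rpow _ hs1', ENNReal.div_mul_cancel (by simpa using hs1')
            ENNReal.ofReal_ne_top, ENNReal.coe_mul, ENNReal.ofReal, mul_assoc]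
  have hps : (p / 2 : ℝ) = s⁻¹ := by rw [hs, inv_div]
  have h := ENNReal.rpow_le_rpow key (inv_nonneg.2 hs0.le)
  rw [ENNReal.rpow_rpow_inv hs0.ne', ENNReal.mul_rpow_of_nonneg _ _ (by positivity),
    ENNReal.mul_rpow_of_nonneg _ _ (by positivity), ← ENNReal.rpow_mul] at h
  rw [hps, ENNReal.coe_rpow_of_nonneg _ (by positivity)]
  convert h using 4
  field_simp

theorem exists_gagliardoNirenberg {d : ℕ} (hd : 1 ≤ d) {θ q : ℝ} (hθ : 0 < θ) (hθ1 : θ < 1)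
    (hq : 0 < q) (hqθ : q⁻¹ = 1 / 2 - θ / d) :
    ∃ C : ℝ≥0, ∀ w : (Fin d → ℝ) → ℝ, ContDiff ℝ 1 w → HasCompactSupport w →
      eLpNorm w (ENNReal.ofReal q) volume
        ≤ C * (eLpNorm w 2 volume ^ (1 - θ) * eLpNorm (fderiv ℝ w) 2 volume ^ θ) := by
  have hd0 : (0 : ℝ) < d := by exact_mod_cast hd
  rcases le_or_gt (1 / 2) θ with h | h
  · have h1 : (1 : ℝ≥0) ≤ (2 * θ).toNNReal := by
      rw [Real.one_le_toNNReal]; linarith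
    have h2 : (2 * θ).toNNReal < 2 := by
      rw [Real.toNNReal_lt_iff_lt_coe (by positivity)]; push_cast; linarith
    have hqθ0 : 0 < q * θ := by positivity
    have hp' : (ENNReal.ofReal (q * θ))⁻¹ + (d : ℝ≥0∞)⁻¹ = ((2 * θ).toNNReal : ℝ≥0∞)⁻¹ := by
      rw [← ENNReal.ofReal_inv_of_pos hqθ0, ← ENNReal.ofReal_natCast,
        ← ENNReal.ofReal_inv_of_pos hd0, ← ENNReal.ofReal_add (by positivity) (by positivity)]
      change _ = (ENNReal.ofReal (2 * θ))⁻¹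
      rw [← ENNReal.ofReal_inv_of_pos (by positivity), mul_inv, hqθ]
      congr 1
      field_simp
      ring
    obtain ⟨C, hC⟩ := exists_eLpNorm_le_mul_of_sobolev hd h1 h2 hp'
    refine ⟨C, fun w hw h2w ↦ ?_⟩
    have := hC w hw h2w
    rw [Real.coe_toNNReal _ (by positivity), ← ENNReal.ofReal_mul hqθ0.le] at this
    convert this using 4
    · field_simp
    · ring
    · ring
  · have hp' : ((1 - (d : ℝ≥0∞)⁻¹)⁻¹)⁻¹ + (d : ℝ≥0∞)⁻¹ = ((1 : ℝ≥0) : ℝ≥0∞)⁻¹ := by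
      rw [inv_inv, tsub_add_cancel_of_le (by simpa using hd)]
      simp
    obtain ⟨C, hC⟩ := exists_eLpNorm_le_mul_of_sobolev hd le_rfl one_lt_two hp'
    refine ⟨C ^ (2 * θ), fun w hw h2w ↦ ?_⟩
    have hexp : ENNReal.ofReal (1 - 2 * θ) * 2⁻¹ + ENNReal.ofReal (2 * θ) *
        ((1 - (d : ℝ≥0∞)⁻¹)⁻¹ * ENNReal.ofReal (2 / (1 : ℝ≥0)))⁻¹ = (ENNReal.ofReal q)⁻¹ := by
      rw [ENNReal.mul_inv (.inr (by finiteness)) (.inr (by simp)), inv_inv,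
        ← ENNReal.ofReal_inv_of_pos hq, hqθ]
      have h2 : (2 : ℝ≥0∞)⁻¹ = ENNReal.ofReal (1 / 2) := by
        rw [one_div, ENNReal.ofReal_inv_of_pos two_pos, ENNReal.ofReal_ofNat]
      have h3 : (1 - (d : ℝ≥0∞)⁻¹) = ENNReal.ofReal (1 - (d : ℝ)⁻¹) := by
        rw [ENNReal.ofReal_sub _ (by positivity), ENNReal.ofReal_inv_of_pos hd0]
        simp
      have h4 : (0 : ℝ) ≤ 1 - (d : ℝ)⁻¹ := by
        rw [sub_nonneg]; exact inv_le_one_of_one_le₀ (by exact_mod_cast hd)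
      have h5 : 0 ≤ 1 - 2 * θ := by linarith
      rw [show ENNReal.ofReal (2 / (1 : ℝ≥0)) = 2 by simp, h2, h3,
        ← ENNReal.ofReal_mul h4, ← ENNReal.ofReal_mul h5, ← ENNReal.ofReal_mul (by positivity),
        ← ENNReal.ofReal_add (by positivity) (by positivity)]
      congr 1
      field_simp
      ring
    calc eLpNorm w (ENNReal.ofReal q) volume
        ≤ eLpNorm w 2 volume ^ (1 - 2 * θ) * _ ^ (2 * θ) :=
          eLpNorm_le_eLpNorm_rpow_mul_eLpNorm_rpow hw.continuous.aestronglyMeasurable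
            (by positivity) (by linarith) hexp
      _ ≤ _ := mul_le_mul_right (ENNReal.rpow_le_rpow (hC w hw h2w) (by positivity)) _
      _ = _ := by
          rw [ENNReal.mul_rpow_of_nonneg _ _ (by positivity),
            ENNReal.mul_rpow_of_nonneg _ _ (by positivity), ← ENNReal.rpow_mul,
            ← ENNReal.rpow_mul, ENNReal.coe_rpow_of_nonneg _ (by positivity),
            show 1 - θ = (1 - 2 * θ) + θ by ring,
            ENNReal.rpow_add_of_nonneg _ _ (by linarith) hθ.le]
          simp only [NNReal.coe_one]
          rw [show (1 - 1 / 2) * (2 * θ) = θ by ring, show 1 / 2 * (2 * θ) = θ by ring]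
          ring

theorem exists_integral_rpow_le {d : ℕ} (hd : 1 ≤ d) {r q : ℝ} (hr : 2 < r) (hq : 2 < q)
    (hrq : 1 / r + d / (2 * q) = d / 4) :
    ∃ C : ℝ, 0 ≤ C ∧ ∀ w : (Fin d → ℝ) → ℝ, ContDiff ℝ 1 w → HasCompactSupport w →
      (∫ x, |w x| ^ q) ^ (r / q)
        ≤ C ^ r * ((∫ x, |w x| ^ 2) ^ (r / 2 - 1) * ∫ x, ‖fderiv ℝ w x‖ ^ 2) := by
  have hd0 : (0 : ℝ) < d := by exact_mod_cast hd
  have hq0 : 0 < q := by linarith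
  have hr0 : 0 < r := by linarith
  have hqθ : q⁻¹ = 1 / 2 - (2 / r) / d := by
    field_simp at hrq ⊢
    linarith
  obtain ⟨C, hC⟩ := exists_gagliardoNirenberg hd (θ := 2 / r) (by positivity)
    ((div_lt_one hr0).2 hr) hq0 hqθ
  refine ⟨C, C.2, fun w hw h2w ↦ ?_⟩
  have hC := hC w hw h2w
  have hw1 : Continuous (fderiv ℝ w) := hw.continuous_fderiv one_ne_zero
  rw [(hw.continuous.memLp_of_hasCompactSupport h2w).eLpNorm_eq_integral_rpow_norm
      (by simpa using hq0) ENNReal.ofReal_ne_top,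
    (hw.continuous.memLp_of_hasCompactSupport h2w).eLpNorm_eq_integral_rpow_norm
      two_ne_zero ENNReal.ofNat_ne_top,
    (hw1.memLp_of_hasCompactSupport (h2w.fderiv ℝ)).eLpNorm_eq_integral_rpow_norm
      two_ne_zero ENNReal.ofNat_ne_top, ENNReal.toReal_ofReal hq0.le] at hC
  simp only [ENNReal.toReal_ofNat, rpow_two, norm_eq_abs] at hC
  have hA : 0 ≤ ∫ x, |w x| ^ q := integral_nonneg fun x ↦ by positivity
  have hB : 0 ≤ ∫ x, |w x| ^ 2 := integral_nonneg fun x ↦ by positivity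
  have hG : 0 ≤ ∫ x, ‖fderiv ℝ w x‖ ^ 2 := integral_nonneg fun x ↦ by positivity
  have hθ1 : 0 ≤ 1 - 2 / r := by rw [sub_nonneg]; exact (div_le_one hr0).2 hr.le
  rw [ENNReal.ofReal_rpow_of_nonneg (by positivity) hθ1,
    ENNReal.ofReal_rpow_of_nonneg (by positivity) (by positivity),
    ← ENNReal.ofReal_mul (by positivity), ← ENNReal.ofReal_coe_nnreal,
    ← ENNReal.ofReal_mul C.coe_nonneg, ENNReal.ofReal_le_ofReal_iff (by positivity)] at hC
  have h := rpow_le_rpow (by positivity) hC hr0.le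
  rw [mul_rpow (by positivity) (by positivity), mul_rpow (by positivity) (by positivity),
    ← rpow_mul hA, ← rpow_mul hB, ← rpow_mul hB, ← rpow_mul hG, ← rpow_mul hG] at h
  convert h using 3
  · field_simp
  · congr 1
    field_simp
  · rw [show (2 : ℝ)⁻¹ * (2 / r) * r = 1 by field_simp, rpow_one]

section Slices

variable {E : Type*} [NormedAddCommGroup E] [NormedSpace ℝ E] {v : ℝ → E → ℝ}

theorem ContDiff.slice (hv : ContDiff ℝ 1 (Function.uncurry v)) (t : ℝ) : ContDiff ℝ 1 (v t) :=
  hv.comp (contDiff_prodMk_right t)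

theorem eq_zero_of_notMem_image_snd_tsupport {E : Type*} [TopologicalSpace E] {v : ℝ → E → ℝ}
    {t : ℝ} {x : E} (hx : x ∉ Prod.snd '' tsupport (Function.uncurry v)) : v t x = 0 :=
  image_eq_zero_of_notMem_tsupport (f := Function.uncurry v) fun h ↦ hx ⟨(t, x), h, rfl⟩

theorem HasCompactSupport.slice {E : Type*} [TopologicalSpace E] [R1Space E] {v : ℝ → E → ℝ}
    (hv : HasCompactSupport (Function.uncurry v)) (t : ℝ) : HasCompactSupport (v t) :=
  .intro (hv.isCompact.image continuous_snd) fun _ hx ↦ eq_zero_of_notMem_image_snd_tsupport hx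

theorem continuous_fderiv_slice (hv : ContDiff ℝ 1 (Function.uncurry v)) :
    Continuous fun z : ℝ × E ↦ fderiv ℝ (v z.1) z.2 := by
  have h (z : ℝ × E) : fderiv ℝ (v z.1) z.2 =
      (fderiv ℝ (Function.uncurry v) z).comp (.inr ℝ ℝ E) :=
    (HasFDerivAt.comp (g := Function.uncurry v) (f := fun x ↦ (z.1, x)) z.2
      (hv.differentiable one_ne_zero z).hasFDerivAt (hasFDerivAt_prodMk_right z.1 z.2)).fderiv
  simp_rw [h]
  exact (hv.continuous_fderiv one_ne_zero).clm_comp continuous_const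

theorem bddAbove_integral_abs_rpow_slice {E : Type*} [NormedAddCommGroup E] [MeasurableSpace E]
    {v : ℝ → E → ℝ} {μ : Measure E} [IsFiniteMeasureOnCompacts μ] (hc : Continuous (Function.uncurry v))
    (hv : HasCompactSupport (Function.uncurry v)) {p : ℝ} (hp : 0 < p) :
    BddAbove (Set.range fun t ↦ ∫ x, |v t x| ^ p ∂μ) := by
  obtain ⟨M, hM⟩ := hc.bounded_above_of_compact_support hv
  set K := Prod.snd '' tsupport (Function.uncurry v)
  have hK : IsCompact K := hv.isCompact.image continuous_snd
  refine ⟨M ^ p * μ.real K, ?_⟩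
  rintro _ ⟨t, rfl⟩
  have hzero : ∀ x, x ∉ K → |v t x| ^ p = 0 := fun x hx ↦ by
    rw [eq_zero_of_notMem_image_snd_tsupport hx, abs_zero, zero_rpow hp.ne']
  dsimp only
  rw [← setIntegral_eq_integral_of_forall_compl_eq_zero hzero]
  refine (le_norm_self _).trans (norm_setIntegral_le_of_norm_le_const hK.measure_lt_top
    fun x _ ↦ ?_)
  rw [norm_of_nonneg (by positivity)]
  exact rpow_le_rpow (abs_nonneg _) (hM (t, x)) hp.le

theorem integrable_integral_fderiv_slice [MeasurableSpace E] [BorelSpace E]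
    [FiniteDimensional ℝ E] {μ : Measure E} [IsFiniteMeasureOnCompacts μ] [SFinite μ]
    (hv : ContDiff ℝ 1 (Function.uncurry v)) (h2v : HasCompactSupport (Function.uncurry v))
    {s : ℝ} (hs : 0 < s) :
    Integrable fun t ↦ ∫ x, ‖fderiv ℝ (v t) x‖ ^ 2 * |v t x| ^ s ∂μ := by
  have hcont : Continuous fun z : ℝ × E ↦ ‖fderiv ℝ (v z.1) z.2‖ ^ 2 *
      |Function.uncurry v z| ^ s :=
    ((continuous_fderiv_slice hv).norm.pow 2).mul
      (hv.continuous.abs.rpow_const fun _ ↦ .inr hs.le)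
  have : ProperSpace E := FiniteDimensional.proper ℝ E
  exact (hcont.integrable_of_hasCompactSupport (μ := volume.prod μ)
    (h2v.abs_rpow hs).mul_left).integral_prod_left

end Slices

theorem integral_fderiv_abs_rpow_le {E : Type*} [NormedAddCommGroup E] [NormedSpace ℝ E]
    [MeasurableSpace E] [BorelSpace E] {μ : Measure E} [IsFiniteMeasureOnCompacts μ]
    {u : E → ℝ} (hu : ContDiff ℝ 1 u) (h2u : HasCompactSupport u) {p : ℝ} (hp : 2 < p) :
    ∫ x, ‖fderiv ℝ (fun y ↦ |u y| ^ (p / 2)) x‖ ^ 2 ∂μ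
      ≤ p ^ 2 / 4 * ∫ x, ‖fderiv ℝ u x‖ ^ 2 * |u x| ^ (p - 2) ∂μ := by
  have hcont : Continuous fun x ↦ ‖fderiv ℝ u x‖ ^ 2 * |u x| ^ (p - 2) :=
    ((hu.continuous_fderiv one_ne_zero).norm.pow 2).mul
      (hu.continuous.abs.rpow_const fun _ ↦ .inr (by linarith))
  rw [← integral_const_mul]
  refine integral_mono_of_nonneg (.of_forall fun x ↦ by positivity)
    ((hcont.integrable_of_hasCompactSupport
      (h2u.abs_rpow (by linarith)).mul_left).const_mul _) (.of_forall fun x ↦ ?_)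
  have h := norm_fderiv_norm_rpow_le (hu.differentiable one_ne_zero) (x := x)
    (show 1 < p / 2 by linarith)
  simp only [norm_eq_abs (u _)] at h
  refine (pow_le_pow_left₀ (norm_nonneg _) h 2).trans_eq ?_
  have h2 : |u x| ^ (p - 2) = (|u x| ^ (p / 2 - 1)) ^ 2 := by
    rw [← rpow_mul_natCast (abs_nonneg _)]
    congr 1
    push_cast
    ring
  simp only [h2]
  ring

/-- **parabolic embedding for powers, uniform in `p`.** For `d ≥ 1` and
`r̂, q̂ ∈ (2, ∞)` with `1/r̂ + d/(2q̂) = d/4` there is a constant `N = N(d, r̂, q̂)`,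
independent of `p`, such that for every real `p > 2` and every compactly supported `C¹`
function `v : ℝ × ℝ^d → ℝ`,
`(∫_ℝ (∫_{ℝ^d} |v|^{q̂ p/2} dx)^{r̂/q̂} dt)^{2/r̂}
  ≤ N (sup_t ∫_{ℝ^d} |v(t,·)|^p dx + (p²/4) ∫_ℝ ∫_{ℝ^d} |∇ₓ v|² |v|^{p-2} dx dt)`. -/
theorem statement2 (d : ℕ) (hd : 1 ≤ d) (rh qh : ℝ) (hr : 2 < rh) (hq : 2 < qh)
    (hrq : 1 / rh + d / (2 * qh) = d / 4) :
    ∃ N : ℝ, 0 < N ∧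
      ∀ p : ℝ, 2 < p →
      ∀ v : ℝ → (Fin d → ℝ) → ℝ,
        ContDiff ℝ 1 (Function.uncurry v) → HasCompactSupport (Function.uncurry v) →
        (∫ t : ℝ, (∫ x : Fin d → ℝ, |v t x| ^ (qh * p / 2)) ^ (rh / qh)) ^ (2 / rh)
          ≤ N * ((⨆ t : ℝ, ∫ x : Fin d → ℝ, |v t x| ^ p)
              + (p ^ 2 / 4) *
                ∫ t : ℝ, ∫ x : Fin d → ℝ, ‖fderiv ℝ (v t) x‖ ^ 2 * |v t x| ^ (p - 2)) := by
  obtain ⟨C, hC0, hC⟩ := exists_integral_rpow_le hd hr hq hrq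
  refine ⟨C ^ 2 + 1, by positivity, fun p hp v hv h2v ↦ ?_⟩
  have hr0 : 0 < rh := by linarith
  have he : 0 ≤ rh / 2 - 1 := by linarith
  set S : ℝ := ⨆ t : ℝ, ∫ x : Fin d → ℝ, |v t x| ^ p
  set G : ℝ → ℝ := fun t ↦ ∫ x : Fin d → ℝ, ‖fderiv ℝ (v t) x‖ ^ 2 * |v t x| ^ (p - 2)
  have hG0 (t : ℝ) : 0 ≤ G t := integral_nonneg fun x ↦ by positivity
  have hS0 : 0 ≤ S := Real.iSup_nonneg fun t ↦ integral_nonneg fun x ↦ by positivity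
  set I : ℝ := p ^ 2 / 4 * ∫ t, G t with hI
  have hI0 : 0 ≤ I := mul_nonneg (by positivity) (integral_nonneg hG0)
  have hslice (t : ℝ) : (∫ x : Fin d → ℝ, |v t x| ^ (qh * p / 2)) ^ (rh / qh)
      ≤ C ^ rh * S ^ (rh / 2 - 1) * (p ^ 2 / 4) * G t := by
    have h := hC _ ((hv.slice t).norm_rpow (show 1 < p / 2 by linarith))
      ((h2v.slice t).abs_rpow (by linarith))
    have hpow (x : Fin d → ℝ) (s : ℝ) : |‖v t x‖ ^ (p / 2)| ^ s = |v t x| ^ (s * p / 2) := by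
      rw [abs_of_nonneg (by positivity), ← rpow_mul (norm_nonneg _), norm_eq_abs]
      ring_nf
    simp_rw [← rpow_two, hpow, mul_div_cancel_left₀ p (two_ne_zero (α := ℝ))] at h
    refine h.trans ?_
    rw [mul_assoc (C ^ rh * _), mul_assoc (C ^ rh)]
    gcongr
    · exact le_ciSup (bddAbove_integral_abs_rpow_slice hv.continuous h2v (by linarith)) t
    · simp only [rpow_two]
      exact integral_fderiv_abs_rpow_le (hv.slice t) (h2v.slice t) hp
  have hint : ∫ t, (∫ x : Fin d → ℝ, |v t x| ^ (qh * p / 2)) ^ (rh / qh)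
      ≤ C ^ rh * (S ^ (rh / 2 - 1) * I) := by
    refine (integral_mono_of_nonneg (.of_forall fun t ↦ ?_)
      ((integrable_integral_fderiv_slice hv h2v (by linarith)).const_mul _)
      (.of_forall hslice)).trans_eq ?_
    · exact rpow_nonneg (integral_nonneg fun x ↦ by positivity) _
    · rw [integral_const_mul, hI]
      ring
  calc _ ≤ (C ^ rh * ((S + I) ^ (rh / 2 - 1) * (S + I))) ^ (2 / rh) := by
        refine rpow_le_rpow (integral_nonneg fun t ↦ rpow_nonneg
          (integral_nonneg fun x ↦ by positivity) _) (hint.trans ?_) (by positivity)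
        gcongr <;> linarith
    _ = C ^ 2 * (S + I) := by
        rw [← rpow_add_one' (by positivity) (by linarith), mul_rpow (by positivity) (by positivity),
          ← rpow_mul hC0, ← rpow_mul (by positivity), mul_div_cancel₀ _ hr0.ne', rpow_two,
          show (rh / 2 - 1 + 1) * (2 / rh) = 1 by field_simp; ring, rpow_one]
    _ ≤ (C ^ 2 + 1) * (S + I) := by gcongr; linarith
end

section
/- For every real number p ≥ 4 and all nonnegative real numbers a, b, the inequality p²·a²·b^{p-2} ≤ p^{-p}·a^p + p^9·b^p holds. -/
/-- **Young-type inequality, uniform in `p`.** For every real `p ≥ 4` and all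
nonnegative reals `a, b`: `p² a² b^{p-2} ≤ p^{-p} a^p + p⁹ b^p`. -/
theorem statement14 (p a b : ℝ) (hp : 4 ≤ p) (ha : 0 ≤ a) (hb : 0 ≤ b) :
    p ^ 2 * a ^ 2 * b ^ (p - 2) ≤ p ^ (-p) * a ^ p + p ^ (9 : ℝ) * b ^ p := by
  have hp0 : 0 < p := by linarith
  obtain ⟨x, hx, rfl⟩ : ∃ x, 0 ≤ x ∧ a = p * x := ⟨a / p, by positivity, by field_simp⟩
  have split_sq : ∀ y : ℝ, 0 ≤ y → y ^ p = y ^ 2 * y ^ (p - 2) := fun y hy => by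
    rw [← Real.rpow_natCast, ← Real.rpow_add_of_nonneg hy (by positivity) (by linarith)]
    norm_num
  have cancel : p ^ (-p) * (p * x) ^ p = x ^ p := by
    rw [Real.mul_rpow hp0.le hx, ← mul_assoc, ← Real.rpow_add hp0]
    simp
  have hp9 : p ^ (9 : ℝ) = p ^ 9 := by exact_mod_cast Real.rpow_natCast p 9
  rw [cancel, hp9]
  -- Compare `x` with `p² b`: each regime is controlled by one of the two summands.
  rcases le_total x (p ^ 2 * b) with h | h
  · have hsq : x ^ 2 ≤ (p ^ 2 * b) ^ 2 := by gcongr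
    have hpow : p ^ 8 ≤ p ^ 9 := pow_le_pow_right₀ (by linarith) (by norm_num)
    calc p ^ 2 * (p * x) ^ 2 * b ^ (p - 2) = p ^ 4 * x ^ 2 * b ^ (p - 2) := by ring
      _ ≤ p ^ 4 * (p ^ 2 * b) ^ 2 * b ^ (p - 2) := by gcongr
      _ = p ^ 8 * b ^ p := by rw [split_sq b hb]; ring
      _ ≤ p ^ 9 * b ^ p := by gcongr
      _ ≤ x ^ p + p ^ 9 * b ^ p := le_add_of_nonneg_left (by positivity)
  · have hpow : p ^ 4 ≤ (p ^ 2) ^ (p - 2) := by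
      calc p ^ 4 = (p ^ 2) ^ (2 : ℝ) := by rw [Real.rpow_two]; ring
        _ ≤ (p ^ 2) ^ (p - 2) :=
          Real.rpow_le_rpow_of_exponent_le (by nlinarith) (by linarith)
    calc p ^ 2 * (p * x) ^ 2 * b ^ (p - 2) = x ^ 2 * (p ^ 4 * b ^ (p - 2)) := by ring
      _ ≤ x ^ 2 * ((p ^ 2) ^ (p - 2) * b ^ (p - 2)) := by gcongr
      _ = x ^ 2 * (p ^ 2 * b) ^ (p - 2) := by rw [Real.mul_rpow (by positivity) hb]
      _ ≤ x ^ 2 * x ^ (p - 2) := by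
        gcongr
        linarith
      _ = x ^ p := (split_sq x hx).symm
      _ ≤ x ^ p + p ^ 9 * b ^ p := le_add_of_nonneg_right (by positivity)
end
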